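/- Let δ₀ = 10^{−10}. There exists a constant c > 0 such that for every γ ∈ 𝔊(δ₀) and all s₁, s₂, s₃ ∈ I, the 4×4 determinant whose columns are (γ(s₁), 1), (γ(s₂), 1), (γ(s₃), 1) and (γ'(s₃), 0) satisfies |det| ≥ c |s₁ − s₂| (s₁ − s₃)² (s₂ − s₃)². -/

import Mathlib

open MeasureTheory Real Set
open scoped ENNReal RealInnerProductSpace ContDiff

noncomputable section

abbrev E3 : Type := EuclideanSpace ℝ (Fin 3)

/-- The interval `I = [-1,1]`. -/
def I1 : Set ℝ := Set.Icc (-1 : ℝ) 1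

/-- The moment curve `γ∘(s) = (s, s²/2, s³/6)`. -/
def momentCurve : ℝ → E3 := fun s => !₂[s, s ^ 2 / 2, s ^ 3 / 6]

/-- Membership of `γ` in the class `𝔊(δ₀, M)`. -/
def GammaClass (δ₀ : ℝ) (M : ℕ) (γ : ℝ → E3) : Prop :=
  ContDiff ℝ (⊤ : ℕ∞) γ ∧ γ 0 = 0 ∧
  iteratedDeriv 1 γ 0 = EuclideanSpace.single 0 1 ∧
  iteratedDeriv 2 γ 0 = EuclideanSpace.single 1 1 ∧
  iteratedDeriv 3 γ 0 = EuclideanSpace.single 2 1 ∧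
  ∀ j : ℕ, 1 ≤ j → j ≤ M → ∀ s ∈ I1,
    ‖iteratedDeriv j γ s - iteratedDeriv j momentCurve s‖ ≤ δ₀

/-- `u(ξ) := ⟨γ'(θ₂(ξ)), ξ⟩`. -/
def uF (γ : ℝ → E3) (θ₂ : E3 → ℝ) (ξ : E3) : ℝ := ⟪deriv γ (θ₂ ξ), ξ⟫

/-- First- and second-order divided-difference form of Taylor's theorem at a base point `s₃`,
with bounds on the coefficients coming from bounds on the second and third derivatives. -/
theorem exists_taylor_coefficients {E : Type*} [NormedAddCommGroup E] [NormedSpace ℝ E]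
    [CompleteSpace E] {g : ℝ → E} (hg : ContDiff ℝ 3 g) {K : Set ℝ} (hK : Convex ℝ K) {δ : ℝ}
    (h2 : ∀ s ∈ K, ‖iteratedDeriv 2 g s‖ ≤ δ) (h3 : ∀ s ∈ K, ‖iteratedDeriv 3 g s‖ ≤ δ)
    {s₁ s₂ s₃ : ℝ} (hs₁ : s₁ ∈ K) (hs₂ : s₂ ∈ K) (hs₃ : s₃ ∈ K) :
    ∃ a b : E, ‖a‖ ≤ δ ∧ ‖b‖ ≤ δ ∧
      g s₁ = g s₃ + (s₁ - s₃) • deriv g s₃ + (s₁ - s₃) ^ 2 • a ∧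
      g s₂ = g s₃ + (s₂ - s₃) • deriv g s₃ + (s₂ - s₃) ^ 2 • (a + (s₂ - s₁) • b) := by
  have hδ : 0 ≤ δ := (norm_nonneg _).trans (h2 s₃ hs₃)
  have hd0 : ∀ s, HasDerivAt g (deriv g s) s := fun s =>
    (hg.differentiable (by norm_num) s).hasDerivAt
  have e2 : iteratedDeriv 2 g = deriv (deriv g) := by
    rw [iteratedDeriv_succ, iteratedDeriv_one]
  have hd1 : ∀ s, HasDerivAt (deriv g) (iteratedDeriv 2 g s) s := fun s => by
    have := (hg.differentiable_iteratedDeriv 1 (by norm_num) s).hasDerivAt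
    rw [iteratedDeriv_one] at this
    rwa [e2]
  have hd2 : ∀ s, HasDerivAt (iteratedDeriv 2 g) (iteratedDeriv 3 g s) s := fun s => by
    have := (hg.differentiable_iteratedDeriv 2 (by norm_num) s).hasDerivAt
    rwa [← iteratedDeriv_succ] at this
  have hc : Continuous (iteratedDeriv 2 g) :=
    continuous_iff_continuousAt.2 fun s => (hd2 s).continuousAt
  have hmem : ∀ s ∈ K, ∀ t ∈ Set.Icc (0 : ℝ) 1, s₃ + t * (s - s₃) ∈ K := fun s hs t ht => by
    simpa using hK.add_smul_sub_mem hs₃ hs ht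
  let A : ℝ → E := fun s => ∫ t in (0 : ℝ)..1, (1 - t) • iteratedDeriv 2 g (s₃ + t * (s - s₃))
  have hint : ∀ s, IntervalIntegrable
      (fun t : ℝ => (1 - t) • iteratedDeriv 2 g (s₃ + t * (s - s₃))) volume 0 1 := fun s =>
    Continuous.intervalIntegrable (by fun_prop) _ _
  have hA : ∀ s, g s = g s₃ + (s - s₃) • deriv g s₃ + (s - s₃) ^ 2 • A s := fun s => by
    have hder : ∀ t : ℝ, HasDerivAt
        (fun t => g (s₃ + t * (s - s₃)) + (1 - t) • (s - s₃) • deriv g (s₃ + t * (s - s₃)))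
        ((s - s₃) ^ 2 • (1 - t) • iteratedDeriv 2 g (s₃ + t * (s - s₃))) t := fun t => by
      have hl : HasDerivAt (fun t : ℝ => s₃ + t * (s - s₃)) (s - s₃) t := by
        simpa using ((hasDerivAt_id t).mul_const (s - s₃)).const_add s₃
      have h1 : HasDerivAt (fun t : ℝ => 1 - t) (-1) t := by
        simpa using (hasDerivAt_id t).const_sub 1
      have := ((hd0 _).scomp t hl).add (h1.smul (((hd1 _).scomp t hl).const_smul (s - s₃)))
      refine this.congr_deriv ?_
      simp only [Pi.smul_apply, Function.comp_apply]
      module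
    have := intervalIntegral.integral_eq_sub_of_hasDerivAt (a := 0) (b := 1)
      (fun t _ => hder t) ((hint s).smul ((s - s₃) ^ 2))
    rw [intervalIntegral.integral_smul] at this
    change (s - s₃) ^ 2 • A s = _ at this
    rw [this]
    simp
  have hlip : ∀ x ∈ K, ∀ y ∈ K, ‖iteratedDeriv 2 g y - iteratedDeriv 2 g x‖ ≤ δ * ‖y - x‖ :=
    fun x hx y hy => hK.norm_image_sub_le_of_norm_hasDerivWithin_le
      (fun s _ => (hd2 s).hasDerivWithinAt) h3 hx hy
  have hAnorm : ‖A s₁‖ ≤ δ := by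
    have := intervalIntegral.norm_integral_le_of_norm_le_const (a := 0) (b := 1) (C := δ)
      (f := fun t : ℝ => (1 - t) • iteratedDeriv 2 g (s₃ + t * (s₁ - s₃))) (fun t ht => by
        rw [Set.uIoc_of_le zero_le_one] at ht
        rw [norm_smul, Real.norm_eq_abs, abs_of_nonneg (by linarith [ht.2])]
        have := h2 _ (hmem s₁ hs₁ t ⟨ht.1.le, ht.2⟩)
        nlinarith [ht.1, ht.2])
    simpa using this
  have hAlip : ‖A s₂ - A s₁‖ ≤ δ * |s₂ - s₁| := by
    have := intervalIntegral.norm_integral_le_of_norm_le_const (a := 0) (b := 1)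
      (C := δ * |s₂ - s₁|)
      (f := fun t : ℝ => (1 - t) • iteratedDeriv 2 g (s₃ + t * (s₂ - s₃)) -
        (1 - t) • iteratedDeriv 2 g (s₃ + t * (s₁ - s₃))) (fun t ht => by
        rw [Set.uIoc_of_le zero_le_one] at ht
        have ht' : t ∈ Set.Icc (0 : ℝ) 1 := ⟨ht.1.le, ht.2⟩
        rw [← smul_sub, norm_smul, Real.norm_eq_abs, abs_of_nonneg (by linarith [ht.2])]
        have := hlip _ (hmem s₁ hs₁ t ht') _ (hmem s₂ hs₂ t ht')
        rw [show s₃ + t * (s₂ - s₃) - (s₃ + t * (s₁ - s₃)) = t * (s₂ - s₁) by ring, norm_mul,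
          Real.norm_eq_abs, Real.norm_eq_abs, abs_of_nonneg ht'.1] at this
        have hn : 0 ≤ δ * |s₂ - s₁| := by positivity
        have h4 : δ * (t * |s₂ - s₁|) ≤ δ * |s₂ - s₁| := by nlinarith [ht.2]
        calc _ ≤ 1 * (δ * |s₂ - s₁|) := mul_le_mul (by linarith [ht.1]) (this.trans h4)
                (norm_nonneg _) zero_le_one
          _ = _ := one_mul _)
    rw [intervalIntegral.integral_sub (hint s₂) (hint s₁)] at this
    simpa using this
  refine ⟨A s₁, (s₂ - s₁)⁻¹ • (A s₂ - A s₁), hAnorm, ?_, hA s₁, ?_⟩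
  · rcases eq_or_ne s₂ s₁ with rfl | hne
    · simpa using hδ
    · rw [norm_smul, norm_inv, Real.norm_eq_abs, inv_mul_le_iff₀ (abs_pos.2 (sub_ne_zero.2 hne)),
        mul_comm]
      exact hAlip
  · rcases eq_or_ne s₂ s₁ with rfl | hne
    · simpa using hA s₂
    · rw [smul_inv_smul₀ (sub_ne_zero.2 hne), add_sub_cancel]
      exact hA s₂

theorem contDiff_momentCurve {n : WithTop ℕ∞} : ContDiff ℝ n momentCurve := by
  rw [contDiff_euclidean]
  intro i
  fin_cases i <;> simp [momentCurve] <;> fun_prop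

theorem deriv_momentCurve (s : ℝ) : deriv momentCurve s = !₂[1, s, s ^ 2 / 2] := by
  have h : HasDerivAt (fun s : ℝ => ![s, s ^ 2 / 2, s ^ 3 / 6]) ![1, s, s ^ 2 / 2] s := by
    rw [hasDerivAt_pi]
    intro i
    fin_cases i
    · exact hasDerivAt_id s
    · refine (((hasDerivAt_id s).pow 2).div_const 2).congr_deriv ?_
      simp
    · refine (((hasDerivAt_id s).pow 3).div_const 6).congr_deriv ?_
      simp
      ring
  exact ((PiLp.continuousLinearEquiv 2 ℝ fun _ : Fin 3 => ℝ).symm.hasFDerivAt.comp_hasDerivAt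
    s h).deriv

/-- The triple `(1, s, s²/2), (0, 1/2, s/2 + h/6), (0, 0, 1/6)` has determinant `1/12`, and this
is stable under small perturbations. -/
theorem le_perturbed_det {s h x₀ x₁ x₂ a₀ a₁ a₂ b₀ b₁ b₂ : ℝ} (hs : |s| ≤ 1) (hh : |h| ≤ 2)
    (hx₀ : |x₀| ≤ 1 / 1000) (hx₁ : |x₁| ≤ 1 / 1000) (hx₂ : |x₂| ≤ 1 / 1000)
    (ha₀ : |a₀| ≤ 1 / 1000) (ha₁ : |a₁| ≤ 1 / 1000) (ha₂ : |a₂| ≤ 1 / 1000)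
    (hb₀ : |b₀| ≤ 1 / 1000) (hb₁ : |b₁| ≤ 1 / 1000) (hb₂ : |b₂| ≤ 1 / 1000) :
    1 / 24 ≤ (1 + x₀) * ((1 / 2 + a₁) * (1 / 6 + b₂) - (s / 2 + h / 6 + a₂) * b₁)
      - a₀ * ((s + x₁) * (1 / 6 + b₂) - (s ^ 2 / 2 + x₂) * b₁)
      + b₀ * ((s + x₁) * (s / 2 + h / 6 + a₂) - (s ^ 2 / 2 + x₂) * (1 / 2 + a₁)) := by
  have bound : ∀ {u v U V : ℝ}, |u| ≤ U → |v| ≤ V → |u * v| ≤ U * V := fun hu hv => by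
    rw [abs_mul]
    exact mul_le_mul hu hv (abs_nonneg _) ((abs_nonneg _).trans hu)
  have hss : |s ^ 2 / 2 + x₂| ≤ 1 := by
    rw [abs_le] at *
    constructor <;> nlinarith
  have hsx : |s + x₁| ≤ 2 := by
    rw [abs_le] at *
    constructor <;> linarith
  have hsh : |s / 2 + h / 6 + a₂| ≤ 1 := by
    rw [abs_le] at *
    constructor <;> linarith
  have hb : |1 / 6 + b₂| ≤ 1 := by
    rw [abs_le] at *
    constructor <;> linarith
  have ha : |1 / 2 + a₁| ≤ 1 := by
    rw [abs_le] at *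
    constructor <;> linarith
  have h1 := bound hsh hb₁
  have h2 := bound hsx hb
  have h3 := bound hss hb₁
  have h4 := bound hsx hsh
  have h5 := bound hss ha
  have h6 : |(s + x₁) * (1 / 6 + b₂) - (s ^ 2 / 2 + x₂) * b₁| ≤ 3 := by
    rw [abs_le] at *
    constructor <;> linarith
  have h7 : |(s + x₁) * (s / 2 + h / 6 + a₂) - (s ^ 2 / 2 + x₂) * (1 / 2 + a₁)| ≤ 3 := by
    rw [abs_le] at *
    constructor <;> linarith
  have h8 := bound ha₀ h6
  have h9 := bound hb₀ h7
  have h10 := bound ha₁ hb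
  have h11 : 3 / 40 ≤ (1 / 2 + a₁) * (1 / 6 + b₂) - (s / 2 + h / 6 + a₂) * b₁ := by
    rw [abs_le] at *
    linarith
  have h12 : 999 / 1000 * (3 / 40) ≤
      (1 + x₀) * ((1 / 2 + a₁) * (1 / 6 + b₂) - (s / 2 + h / 6 + a₂) * b₁) :=
    mul_le_mul (by linarith [(abs_le.1 hx₀).1]) h11 (by norm_num)
      (by linarith [(abs_le.1 hx₀).1])
  linarith [(abs_le.1 h8).2, (abs_le.1 h9).1]

theorem det_four_with_ones_row (a b c d e f g h i j k l : ℝ) :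
    Matrix.det !![a, b, c, d; e, f, g, h; i, j, k, l; 1, 1, 1, 0] =
      (b - c) * ((e - g) * l - h * (i - k)) - (a - c) * ((f - g) * l - h * (j - k))
        - d * ((e - g) * (j - k) - (f - g) * (i - k)) := by
  rw [Matrix.det_succ_row_zero]
  simp [Fin.sum_univ_four, Matrix.det_fin_three, Fin.succAbove]
  ring

/-- transversality lower bound for curves in `𝔊(δ₀)`. -/
theorem transversality_lower_bound :
    ∃ c : ℝ, 0 < c ∧
      ∀ γ : ℝ → E3, GammaClass ((10:ℝ) ^ (-(10:ℤ))) 4 γ →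
      ∀ s₁ ∈ I1, ∀ s₂ ∈ I1, ∀ s₃ ∈ I1,
        c * |s₁ - s₂| * (s₁ - s₃)^2 * (s₂ - s₃)^2
          ≤ |Matrix.det !![γ s₁ 0, γ s₂ 0, γ s₃ 0, deriv γ s₃ 0;
                            γ s₁ 1, γ s₂ 1, γ s₃ 1, deriv γ s₃ 1;
                            γ s₁ 2, γ s₂ 2, γ s₃ 2, deriv γ s₃ 2;
                            1,      1,      1,      0]| := by
  refine ⟨1 / 24, by norm_num, fun γ hγ s₁ hs₁ s₂ hs₂ s₃ hs₃ => ?_⟩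
  obtain ⟨hsmooth, -, -, -, -, hclose⟩ := hγ
  have hγ3 : ContDiff ℝ 3 γ := contDiff_infty.1 hsmooth 3
  have hm3 : ContDiff ℝ 3 momentCurve := contDiff_momentCurve
  have hbd : ∀ j : ℕ, 1 ≤ j → j ≤ 3 → ∀ s ∈ I1,
      ‖iteratedDeriv j (γ - momentCurve) s‖ ≤ 1 / 1000 := fun j h1 h3 s hs => by
    have hj : (j : WithTop ℕ∞) ≤ 3 := by exact_mod_cast h3
    rw [iteratedDeriv_sub (hγ3.of_le hj).contDiffAt (hm3.of_le hj).contDiffAt]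
    exact (hclose j h1 (by lia) s hs).trans (by norm_num)
  obtain ⟨a, b, ha, hb, e1, e2⟩ := exists_taylor_coefficients (g := γ - momentCurve)
    (hγ3.sub hm3) (convex_Icc (-1) 1)
    (hbd 2 (by norm_num) (by norm_num)) (hbd 3 (by norm_num) le_rfl) hs₁ hs₂ hs₃
  have hx := hbd 1 le_rfl (by norm_num) s₃ hs₃
  rw [iteratedDeriv_one] at hx
  have hderiv : deriv γ s₃ = deriv momentCurve s₃ + deriv (γ - momentCurve) s₃ := by
    rw [deriv_sub (hγ3.differentiable (by norm_num) s₃) (hm3.differentiable (by norm_num) s₃)]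
    abel
  set x := deriv (γ - momentCurve) s₃
  clear_value x
  have coord : ∀ {v : E3}, ‖v‖ ≤ 1 / 1000 → ∀ i, |v i| ≤ 1 / 1000 := fun hv i =>
    (PiLp.norm_apply_le _ i).trans hv
  have key := le_perturbed_det (s := s₃) (h := s₁ - s₃) (abs_le.2 hs₃)
    (abs_le.2 ⟨by linarith [hs₁.1, hs₃.2], by linarith [hs₁.2, hs₃.1]⟩)
    (coord hx 0) (coord hx 1) (coord hx 2) (coord ha 0) (coord ha 1) (coord ha 2)
    (coord hb 0) (coord hb 1) (coord hb 2)
  have c1 := fun i : Fin 3 => congrArg (fun v : E3 => v i) e1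
  have c2 := fun i : Fin 3 => congrArg (fun v : E3 => v i) e2
  have d := fun i : Fin 3 => congrArg (fun v : E3 => v i) hderiv
  have c10 := c1 0
  have c11 := c1 1
  have c12 := c1 2
  have c20 := c2 0
  have c21 := c2 1
  have c22 := c2 2
  have d0 := d 0
  have d1 := d 1
  have d2 := d 2
  simp [momentCurve, sub_eq_iff_eq_add] at c10 c11 c12 c20 c21 c22
  simp [deriv_momentCurve] at d0 d1 d2
  generalize hD : (1 + x 0) * ((1 / 2 + a 1) * (1 / 6 + b 2) - _) - _ + _ = D at key
  have hdet : ∀ Δ : ℝ, Δ = (s₁ - s₂) * (s₁ - s₃) ^ 2 * (s₂ - s₃) ^ 2 * D →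
      1 / 24 * |s₁ - s₂| * (s₁ - s₃) ^ 2 * (s₂ - s₃) ^ 2 ≤ |Δ| := by
    rintro _ rfl
    rw [abs_mul, abs_mul, abs_mul, abs_of_nonneg (sq_nonneg (s₁ - s₃)),
      abs_of_nonneg (sq_nonneg (s₂ - s₃))]
    have := mul_le_mul_of_nonneg_left (key.trans (le_abs_self D))
      (by positivity : 0 ≤ |s₁ - s₂| * (s₁ - s₃) ^ 2 * (s₂ - s₃) ^ 2)
    linarith
  apply hdet
  rw [det_four_with_ones_row, c10, c11, c12, c20, c21, c22, d0, d1, d2, ← hD]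
  ring
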